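/- Let ∇ be the affine connection on ℝ⁴ determined on coordinate vector fields by ∇_{∂₁}∂₁ = −∂₂, ∇_{∂₃}∂₃ = ∂₂, ∇_{∂₁}∂₂ = ∇_{∂₂}∂₁ = e^{−x₂}∂₁ + e^{x₁}∂₄, ∇_{∂₃}∂₄ = ∇_{∂₄}∂₃ = −e^{−x₂}∂₁ − e^{x₁}∂₄, ∇_{∂₁}∂₃ = ∇_{∂₃}∂₁ = ∂₄, ∇_{∂₁}∂₄ = ∇_{∂₄}∂₁ = ∇_{∂₂}∂₃ = ∇_{∂₃}∂₂ = e^{x₁}∂₂ − e^{−x₂}∂₃, ∇_{∂₂}∂₂ = −e^{x₁−x₂}∂₃, ∇_{∂₄}∂₄ = e^{x₁−x₂}∂₃, ∇_{∂₂}∂₄ = ∇_{∂₄}∂₂ = −e^{x₁−x₂}∂₁ − ∂₄; let g be the x-dependent symmetric bilinear form on ℝ⁴ with matrix diag(−1, e^{−x₂}, −1, e^{−x₂}); let J be the constant linear map on ℝ⁴ with matrix rows (0,0,1,0), (0,0,0,1), (−1,0,0,0), (0,−1,0,0); and define the 2-form ω(E,F) = g(E, JF). Then ω is ∇-parallel: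 for all indices i, j, k ∈ {1,2,3,4} and every point of ℝ⁴, ∂_i ω_{jk} − Σ_l Γ^l_{ij} ω_{lk} − Σ_l Γ^l_{ik} ω_{jl} = 0, where Γ^l_{ij} are the Christoffel symbols of ∇ and ω_{jk} = ω(∂_j, ∂_k). -/

import Mathlib

/-- The Christoffel symbols of the affine connection `∇` of Example 1 on `ℝ⁴`:
`Γ4 x i j l` is the `∂_l`-component of `∇_{∂_i} ∂_j` at the point `x`. -/
noncomputable def Γ4 (x : Fin 4 → ℝ) : Fin 4 → Fin 4 → Fin 4 → ℝ :=
  ![![![0, -1, 0, 0],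
      ![Real.exp (-(x 1)), 0, 0, Real.exp (x 0)],
      ![0, 0, 0, 1],
      ![0, Real.exp (x 0), -Real.exp (-(x 1)), 0]],
    ![![Real.exp (-(x 1)), 0, 0, Real.exp (x 0)],
      ![0, 0, -Real.exp (x 0 - x 1), 0],
      ![0, Real.exp (x 0), -Real.exp (-(x 1)), 0],
      ![-Real.exp (x 0 - x 1), 0, 0, -1]],
    ![![0, 0, 0, 1],
      ![0, Real.exp (x 0), -Real.exp (-(x 1)), 0],
      ![0, 1, 0, 0],
      ![-Real.exp (-(x 1)), 0, 0, -Real.exp (x 0)]],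
    ![![0, Real.exp (x 0), -Real.exp (-(x 1)), 0],
      ![-Real.exp (x 0 - x 1), 0, 0, -1],
      ![-Real.exp (-(x 1)), 0, 0, -Real.exp (x 0)],
      ![0, 0, Real.exp (x 0 - x 1), 0]]]

/-- The metric `g = diag(−1, e^{−x₂}, −1, e^{−x₂})` on `ℝ⁴`. -/
noncomputable def g4 (x : Fin 4 → ℝ) : Fin 4 → Fin 4 → ℝ :=
  ![![-1, 0, 0, 0],
    ![0, Real.exp (-(x 1)), 0, 0],
    ![0, 0, -1, 0],
    ![0, 0, 0, Real.exp (-(x 1))]]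

/-- The constant almost complex structure `J` on `ℝ⁴`: `Jmat l k` is the `∂_l`-component
of `J ∂_k`. -/
def Jmat : Fin 4 → Fin 4 → ℝ :=
  ![![0, 0, 1, 0],
    ![0, 0, 0, 1],
    ![-1, 0, 0, 0],
    ![0, -1, 0, 0]]

/-- The fundamental 2-form `ω(E, F) = g(E, JF)` in coordinates: `ω x j k = ω(∂_j, ∂_k)`. -/
noncomputable def ω4 (x : Fin 4 → ℝ) (j k : Fin 4) : ℝ :=
  ∑ l, g4 x j l * Jmat l k

/-- The components of `ω = -dx₁ ∧ dx₃ + e^{-x₂} dx₂ ∧ dx₄`. -/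
theorem omega4_eq (x : Fin 4 → ℝ) : ω4 x =
    ![![0, 0, -1, 0],
      ![0, 0, 0, Real.exp (-(x 1))],
      ![1, 0, 0, 0],
      ![0, -Real.exp (-(x 1)), 0, 0]] := by
  ext j k
  fin_cases j <;> fin_cases k <;> simp [ω4, g4, Jmat, Fin.sum_univ_four]

theorem fderiv_exp_neg_coord_one (p v : Fin 4 → ℝ) :
    fderiv ℝ (fun x : Fin 4 → ℝ => Real.exp (-(x 1))) p v = -(Real.exp (-(p 1)) * v 1) := by
  have h : HasFDerivAt (fun x : Fin 4 → ℝ => Real.exp (-(x 1))) _ p :=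
    ((hasFDerivAt_apply (𝕜 := ℝ) (1 : Fin 4) p).neg).exp
  rw [h.fderiv]
  simp

/-- The 2-form `ω(E,F) = g(E, JF)` is `∇`-parallel: `(∇_{∂_i} ω)(∂_j, ∂_k) = 0` at every
point of `ℝ⁴`. -/
theorem omega_parallel_R4 :
    ∀ (i j k : Fin 4) (p : Fin 4 → ℝ),
      fderiv ℝ (fun x => ω4 x j k) p (Pi.single i 1)
          - (∑ l, Γ4 p i j l * ω4 p l k) - (∑ l, Γ4 p i k l * ω4 p j l) = 0 := by
  intro i j k p
  have hexp : Real.exp (p 0 - p 1) = Real.exp (p 0) * Real.exp (-(p 1)) := by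
    rw [← Real.exp_add, sub_eq_add_neg]
  simp only [omega4_eq, Fin.sum_univ_four]
  fin_cases j <;> fin_cases k <;> fin_cases i <;>
    simp [Γ4, fderiv_exp_neg_coord_one, hexp, mul_comm]
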